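/- Let K be a positive integer and let Φ ∈ ℝ^{M×N} satisfy the restricted isometry property of order K+1 with constant δ ∈ (0,1). Then for every x ∈ ℝ^N with at most 3⌈K/2⌉ nonzero entries, (1−3δ)·‖x‖₂² ≤ ‖Φx‖₂² ≤ (1+3δ)·‖x‖₂², i.e., the RIP inequalities of order 3⌈K/2⌉ hold with constant 3δ. -/

import Mathlib

open Finset

/-- The Euclidean (ℓ²) norm of a vector in ℝⁿ. -/
noncomputable def l2norm {n : ℕ} (v : Fin n → ℝ) : ℝ := Real.sqrt (∑ i, v i ^ 2)

/-- The Euclidean inner product on ℝᵐ. -/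
noncomputable def dot {m : ℕ} (u v : Fin m → ℝ) : ℝ := ∑ k, u k * v k

/-- `x` has at most `s` nonzero entries. -/
noncomputable def sparse {n : ℕ} (s : ℕ) (x : Fin n → ℝ) : Prop :=
  (Finset.univ.filter (fun i => x i ≠ 0)).card ≤ s

/-- `Φ` satisfies the restricted isometry property of order `s` with constant `δ`. -/
noncomputable def RIP {M N : ℕ} (Φ : Matrix (Fin M) (Fin N) ℝ) (s : ℕ) (δ : ℝ) : Prop :=
  ∀ x : Fin N → ℝ, sparse s x →
    (1 - δ) * l2norm x ^ 2 ≤ l2norm (Φ.mulVec x) ^ 2 ∧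
    l2norm (Φ.mulVec x) ^ 2 ≤ (1 + δ) * l2norm x ^ 2

theorem l2norm_sq_eq {n : ℕ} (v : Fin n → ℝ) : l2norm v ^ 2 = ∑ i, v i ^ 2 := by
  unfold l2norm
  exact Real.sq_sqrt (Finset.sum_nonneg fun i _ => sq_nonneg _)

theorem l2norm_sq_three {n : ℕ} (a b c : Fin n → ℝ) :
    l2norm (a + b + c) ^ 2 = l2norm (a + b) ^ 2 + l2norm (a + c) ^ 2 + l2norm (b + c) ^ 2
      - l2norm a ^ 2 - l2norm b ^ 2 - l2norm c ^ 2 := by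
  simp only [l2norm_sq_eq, ← Finset.sum_add_distrib, ← Finset.sum_sub_distrib, Pi.add_apply]
  exact Finset.sum_congr rfl fun i _ => by ring

theorem l2norm_sq_add {n : ℕ} (a b : Fin n → ℝ) (h : ∀ i, a i * b i = 0) :
    l2norm (a + b) ^ 2 = l2norm a ^ 2 + l2norm b ^ 2 := by
  simp only [l2norm_sq_eq, ← Finset.sum_add_distrib, Pi.add_apply]
  exact Finset.sum_congr rfl fun i _ => by linear_combination 2 * h i

theorem sparse_of_subset {n s : ℕ} (x : Fin n → ℝ) (A : Finset (Fin n))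
    (h : ∀ i, i ∉ A → x i = 0) (hA : A.card ≤ s) : sparse s x := by
  refine le_trans (Finset.card_le_card fun i hi => ?_) hA
  by_contra hc
  exact (Finset.mem_filter.1 hi).2 (h i hc)

theorem exists_three_parts {α : Type*} [DecidableEq α] (S : Finset α) (h : ℕ)
    (hS : S.card ≤ 3 * h) :
    ∃ A B C : Finset α, A.card ≤ h ∧ B.card ≤ h ∧ C.card ≤ h ∧ Disjoint A B ∧ Disjoint A C ∧
      Disjoint B C ∧ ∀ i ∈ S, i ∈ A ∨ i ∈ B ∨ i ∈ C := by
  obtain ⟨A, hA, hAc⟩ := Finset.exists_subset_card_eq (min_le_right h S.card)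
  obtain ⟨B, hB, hBc⟩ := Finset.exists_subset_card_eq (min_le_right h (S \ A).card)
  have h1 := Finset.card_sdiff_add_card_eq_card hA
  have h2 := Finset.card_sdiff_add_card_eq_card hB
  refine ⟨A, B, (S \ A) \ B, by omega, by omega, by omega, ?_, ?_, ?_, ?_⟩
  · exact Finset.disjoint_of_subset_right hB Finset.disjoint_sdiff
  · exact Finset.disjoint_of_subset_right Finset.sdiff_subset Finset.disjoint_sdiff
  · exact Finset.disjoint_sdiff
  · intro i hi
    simp only [Finset.mem_sdiff]
    tauto

/-- Lemma 4: if `K ≥ 1` and `Φ` has RIP of order `K+1` with constant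
`δ ∈ (0,1)`, then the RIP inequalities of order `3⌈K/2⌉` hold with constant `3δ`.
(`⌈K/2⌉ = (K+1)/2` using natural number division.) -/
theorem stmt_3 {M N : ℕ} (K : ℕ) (hK : 0 < K)
    (Φ : Matrix (Fin M) (Fin N) ℝ) (δ : ℝ)
    (hδ0 : 0 < δ) (hδ1 : δ < 1) (hRIP : RIP Φ (K + 1) δ) :
    ∀ x : Fin N → ℝ, sparse (3 * ((K + 1) / 2)) x →
      (1 - 3 * δ) * l2norm x ^ 2 ≤ l2norm (Φ.mulVec x) ^ 2 ∧
      l2norm (Φ.mulVec x) ^ 2 ≤ (1 + 3 * δ) * l2norm x ^ 2 := by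
  intro x hx
  obtain ⟨A, B, C, hA, hB, hC, hAB, hAC, hBC, hcov⟩ := exists_three_parts _ _ hx
  obtain ⟨r, hr⟩ : ∃ r : Finset (Fin N) → Fin N → ℝ, r = fun T i => if i ∈ T then x i else 0 :=
    ⟨_, rfl⟩
  have hr0 : ∀ T i, i ∉ T → r T i = 0 := fun T i hi => by simp [hr, hi]
  have hdis : ∀ T U, Disjoint T U → ∀ i, r T i * r U i = 0 := by
    intro T U hTU i
    by_cases hi : i ∈ T
    · rw [hr0 U i (Finset.disjoint_left.1 hTU hi), mul_zero]
    · rw [hr0 T i hi, zero_mul]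
  have hsum : x = r A + r B + r C := by
    funext i
    have d1 := @Finset.disjoint_left _ A B
    have d2 := @Finset.disjoint_left _ A C
    have d3 := @Finset.disjoint_left _ B C
    by_cases hi : x i = 0
    · simp [hr, hi]
    · rcases hcov i (by simp [hi]) with h | h | h
      · simp [hr, h, d1.1 hAB h, d2.1 hAC h]
      · simp [hr, h, Finset.disjoint_right.1 hAB h, d3.1 hBC h]
      · simp [hr, h, Finset.disjoint_right.1 hAC h, Finset.disjoint_right.1 hBC h]
  have one : ∀ T : Finset (Fin N), T.card ≤ (K + 1) / 2 → sparse (K + 1) (r T) := fun T hT =>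
    sparse_of_subset _ T (hr0 T) (by omega)
  have two : ∀ T U : Finset (Fin N), T.card ≤ (K + 1) / 2 → U.card ≤ (K + 1) / 2 →
      sparse (K + 1) (r T + r U) := by
    intro T U hT hU
    refine sparse_of_subset _ (T ∪ U) (fun i hi => ?_) ((Finset.card_union_le T U).trans (by omega))
    rw [Finset.mem_union, not_or] at hi
    simp [hr0 T i hi.1, hr0 U i hi.2]
  have a1 := hRIP _ (one A hA)
  have a2 := hRIP _ (one B hB)
  have a3 := hRIP _ (one C hC)
  have b1 := hRIP _ (two A B hA hB)
  have b2 := hRIP _ (two A C hA hC)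
  have b3 := hRIP _ (two B C hB hC)
  rw [l2norm_sq_add _ _ (hdis A B hAB), Matrix.mulVec_add] at b1
  rw [l2norm_sq_add _ _ (hdis A C hAC), Matrix.mulVec_add] at b2
  rw [l2norm_sq_add _ _ (hdis B C hBC), Matrix.mulVec_add] at b3
  have e1 := l2norm_sq_three (r A) (r B) (r C)
  rw [l2norm_sq_add _ _ (hdis A B hAB), l2norm_sq_add _ _ (hdis A C hAC),
    l2norm_sq_add _ _ (hdis B C hBC)] at e1
  rw [hsum, Matrix.mulVec_add, Matrix.mulVec_add, l2norm_sq_three (Φ.mulVec (r A)), e1]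
  obtain ⟨a1, a1'⟩ := a1
  obtain ⟨a2, a2'⟩ := a2
  obtain ⟨a3, a3'⟩ := a3
  obtain ⟨b1, b1'⟩ := b1
  obtain ⟨b2, b2'⟩ := b2
  obtain ⟨b3, b3'⟩ := b3
  constructor <;> linarith
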